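/- Let T be the triangular lattice graph on vertex set ℤ × ℤ, where two vertices are adjacent if and only if their difference lies in {(1,0), (−1,0), (0,1), (0,−1), (1,−1), (−1,1)}. Then for every ε > 0 there exists k₀ ∈ ℕ such that every finite set P ⊆ ℤ × ℤ with |P| ≥ k₀ has edge-boundary ∂_e(P) ≥ (1 − ε)·4·√(3·|P|). -/

import Mathlib

/-- The generating set of the triangular lattice graph on `ℤ × ℤ`. -/
def triGens : Set (ℤ × ℤ) := {(1, 0), (-1, 0), (0, 1), (0, -1), (1, -1), (-1, 1)}

/-- The edge-boundary of `P` in the triangular lattice: the number of edges with exactly one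
endpoint in `P`, counted as ordered pairs (first endpoint in `P`, second endpoint not in `P`). -/
noncomputable def triBoundary (P : Finset (ℤ × ℤ)) : ℕ :=
  Set.ncard {e : (ℤ × ℤ) × (ℤ × ℤ) | e.1 ∈ P ∧ e.2 ∉ P ∧ e.1 - e.2 ∈ triGens}

/-- If `f + g + h = 0`, deleting the fibre of `f` over its maximum and the fibre of `g` over its
minimum removes at most `#(h(P))` points, since `h` is injective on the deleted set. -/
lemma exists_subset_card_le_add_card_image {α : Type*} [DecidableEq α] (f g h : α → ℤ)
    (hsum : ∀ p, f p + g p + h p = 0) (hinj : ∀ p q, f p = f q → g p = g q → p = q)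
    (P : Finset α) (hP : P.Nonempty) :
    ∃ Q ⊂ P, P.card ≤ Q.card + (P.image h).card ∧ (Q.image f).card + 1 ≤ (P.image f).card ∧
      (Q.image g).card + 1 ≤ (P.image g).card ∧ (Q.image h).card ≤ (P.image h).card := by
  obtain ⟨p₀, hp₀, hmax⟩ := P.exists_max_image f hP
  obtain ⟨q₀, hq₀, hmin⟩ := P.exists_min_image g hP
  have hsub : P.filter (fun p => ¬ (f p = f p₀ ∨ g p = g q₀)) ⊆ P := Finset.filter_subset _ _
  refine ⟨P.filter (fun p => ¬ (f p = f p₀ ∨ g p = g q₀)), ?_, ?_, ?_, ?_, ?_⟩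
  · exact Finset.filter_ssubset.2 ⟨p₀, hp₀, by simp⟩
  · rw [← Finset.card_filter_add_card_filter_not (s := P) (fun p => f p = f p₀ ∨ g p = g q₀),
      add_comm]
    gcongr
    refine Finset.card_le_card_of_injOn h
      (fun p hp => Finset.mem_image_of_mem h (Finset.mem_filter.1 hp).1) ?_
    intro p hp q hq hpq
    simp only [Finset.coe_filter, Set.mem_ofPred_eq] at hp hq
    have := hsum p
    have := hsum q
    have := hmax p hp.1
    have := hmax q hq.1
    have := hmin p hp.1
    have := hmin q hq.1
    apply hinj <;> omega
  · refine Finset.card_lt_card ((Finset.ssubset_iff_of_subset (Finset.image_subset_image hsub)).2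
      ⟨f p₀, Finset.mem_image_of_mem f hp₀, ?_⟩)
    simp only [Finset.mem_image, Finset.mem_filter, not_exists]
    tauto
  · refine Finset.card_lt_card ((Finset.ssubset_iff_of_subset (Finset.image_subset_image hsub)).2
      ⟨g q₀, Finset.mem_image_of_mem g hq₀, ?_⟩)
    simp only [Finset.mem_image, Finset.mem_filter, not_exists]
    tauto
  · exact Finset.card_le_card (Finset.image_subset_image hsub)

/-- A planar set is bounded in size by the number of lines it meets in three directions. -/
lemma twelve_mul_card_le_sq {α : Type*} [DecidableEq α] (f g h : α → ℤ)
    (hsum : ∀ p, f p + g p + h p = 0) (hinj : ∀ p q, f p = f q → g p = g q → p = q)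
    (P : Finset α) :
    12 * P.card ≤ ((P.image f).card + (P.image g).card + (P.image h).card + 1) ^ 2 := by
  induction P using Finset.strongInduction with
  | H P ih =>
    obtain rfl | hP := P.eq_empty_or_nonempty
    · simp
    have key (a b c a' b' c' n n' : ℕ) (hac : c ≤ a) (hbc : c ≤ b) (hn : n ≤ n' + c)
        (ha : a' + 1 ≤ a) (hb : b' + 1 ≤ b) (hc : c' ≤ c)
        (hn' : 12 * n' ≤ (a' + b' + c' + 1) ^ 2) : 12 * n ≤ (a + b + c + 1) ^ 2 := by
      have h₁ : a' + b' + c' + 1 + 2 ≤ a + b + c + 1 := by omega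
      obtain ⟨t, ht⟩ := Nat.exists_eq_add_of_le h₁
      have h₂ : 12 * c ≤ 4 * (a' + b' + c' + 2 + t) := by omega
      rw [ht]
      calc 12 * n ≤ (a' + b' + c' + 1) ^ 2 + 4 * (a' + b' + c' + 2 + t) := by omega
        _ ≤ (a' + b' + c' + 1) ^ 2 + 4 * (a' + b' + c' + 2 + t) +
            (2 * t * (a' + b' + c' + 1) + t ^ 2) := Nat.le_add_right _ _
        _ = _ := by ring
    have hcases : ((P.image h).card ≤ (P.image f).card ∧ (P.image h).card ≤ (P.image g).card) ∨
        ((P.image f).card ≤ (P.image g).card ∧ (P.image f).card ≤ (P.image h).card) ∨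
        ((P.image g).card ≤ (P.image h).card ∧ (P.image g).card ≤ (P.image f).card) := by omega
    obtain ⟨h₁, h₂⟩ | ⟨h₁, h₂⟩ | ⟨h₁, h₂⟩ := hcases
    · obtain ⟨Q, hQ, hn, ha, hb, hc⟩ :=
        exists_subset_card_le_add_card_image f g h hsum hinj P hP
      exact key _ _ _ _ _ _ _ _ h₁ h₂ hn ha hb hc (ih Q hQ)
    · obtain ⟨Q, hQ, hn, ha, hb, hc⟩ :=
        exists_subset_card_le_add_card_image g h f (fun p => by linarith [hsum p])
          (fun p q hg hh => hinj p q (by linarith [hsum p, hsum q]) hg) P hP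
      have := key _ _ _ _ _ _ _ _ h₁ h₂ hn ha hb hc ((ih Q hQ).trans_eq (by ring))
      exact this.trans_eq (by ring)
    · obtain ⟨Q, hQ, hn, ha, hb, hc⟩ :=
        exists_subset_card_le_add_card_image h f g (fun p => by linarith [hsum p])
          (fun p q hh hf => hinj p q hf (by linarith [hsum p, hsum q])) P hP
      have := key _ _ _ _ _ _ _ _ h₁ h₂ hn ha hb hc ((ih Q hQ).trans_eq (by ring))
      exact this.trans_eq (by ring)

/-- Every line in direction `d` meeting `P` leaves `P` along an edge in direction `-d`. -/
lemma card_image_le_card_filter_sub_notMem (P : Finset (ℤ × ℤ)) (d : ℤ × ℤ) (hd : d ≠ 0)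
    (f : ℤ × ℤ → ℤ) (hf : ∀ p, f (p - d) = f p) :
    (P.image f).card ≤ (P.filter (fun p => p - d ∉ P)).card := by
  refine (Finset.card_le_card ?_).trans (Finset.card_image_le (f := f))
  intro v hv
  by_contra hcon
  have step (p : ℤ × ℤ) (hp : p ∈ P) (hpv : f p = v) : p - d ∈ P := by
    by_contra hpd
    exact hcon (Finset.mem_image.2 ⟨p, Finset.mem_filter.2 ⟨hp, hpd⟩, hpv⟩)
  obtain ⟨p, hp, hpv⟩ := Finset.mem_image.1 hv
  have hall (k : ℕ) : p - k • d ∈ P ∧ f (p - k • d) = v := by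
    induction k with
    | zero => simpa using ⟨hp, hpv⟩
    | succ k ih =>
      rw [succ_nsmul, ← sub_sub, hf]
      exact ⟨step _ ih.1 ih.2, ih.2⟩
  have hinj : Function.Injective (fun k : ℕ => p - k • d) := by
    intro k l hkl
    have hkl' : (k : ℤ) • d = (l : ℤ) • d := by simpa using hkl
    exact_mod_cast smul_left_injective ℤ hd hkl'
  exact Set.infinite_of_injective_forall_mem hinj (fun k => (hall k).1) P.finite_toSet

/-- The generators of the triangular lattice as a finset. -/
def triGensFinset : Finset (ℤ × ℤ) := {(1, 0), (-1, 0), (0, 1), (0, -1), (1, -1), (-1, 1)}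

lemma triBoundary_eq_sum (P : Finset (ℤ × ℤ)) :
    triBoundary P = ∑ d ∈ triGensFinset, (P.filter (fun p => p - d ∉ P)).card := by
  classical
  rw [← Finset.card_sigma, triBoundary, ← Set.ncard_coe_finset]
  symm
  refine Set.ncard_congr (fun x _ => (x.2, x.2 - x.1)) ?_ ?_ ?_
  · rintro ⟨d, p⟩ hx
    simpa [triGensFinset, triGens, and_assoc, and_comm, and_left_comm] using hx
  · rintro ⟨d, p⟩ ⟨d', p'⟩ - - hx
    simp only [Prod.mk.injEq] at hx
    obtain ⟨rfl, hx⟩ := hx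
    obtain rfl := sub_right_injective hx
    rfl
  · rintro ⟨p, q⟩ ⟨hp, hq, hpq⟩
    refine ⟨⟨p - q, p⟩, ?_, by simp⟩
    simp only [Finset.coe_sigma, Set.mem_sigma_iff, Finset.mem_coe, Finset.mem_filter,
      sub_sub_cancel]
    exact ⟨by simpa [triGensFinset, triGens] using hpq, hp, hq⟩

lemma two_mul_card_images_le_triBoundary (P : Finset (ℤ × ℤ)) :
    2 * ((P.image fun p => p.1).card + (P.image fun p => p.2).card +
      (P.image fun p => -(p.1 + p.2)).card) ≤ triBoundary P := by
  have h₁ := card_image_le_card_filter_sub_notMem P (1, 0) (by simp) (fun p => p.2) (by simp)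
  have h₂ := card_image_le_card_filter_sub_notMem P (-1, 0) (by simp) (fun p => p.2) (by simp)
  have h₃ := card_image_le_card_filter_sub_notMem P (0, 1) (by simp) (fun p => p.1) (by simp)
  have h₄ := card_image_le_card_filter_sub_notMem P (0, -1) (by simp) (fun p => p.1) (by simp)
  have h₅ := card_image_le_card_filter_sub_notMem P (1, -1) (by simp) (fun p => -(p.1 + p.2))
    (fun p => by simp only [Prod.fst_sub, Prod.snd_sub]; ring)
  have h₆ := card_image_le_card_filter_sub_notMem P (-1, 1) (by simp) (fun p => -(p.1 + p.2))
    (fun p => by simp only [Prod.fst_sub, Prod.snd_sub]; ring)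
  have hsum : triBoundary P = _ := triBoundary_eq_sum P
  rw [triGensFinset, Finset.sum_insert (by decide), Finset.sum_insert (by decide),
    Finset.sum_insert (by decide), Finset.sum_insert (by decide),
    Finset.sum_insert (by decide), Finset.sum_singleton] at hsum
  omega

theorem stmt_15 (ε : ℝ) (hε : 0 < ε) :
    ∃ k₀ : ℕ, ∀ P : Finset (ℤ × ℤ), k₀ ≤ P.card →
      (1 - ε) * 4 * Real.sqrt (3 * P.card) ≤ (triBoundary P : ℝ) := by
  refine ⟨⌈(1 / ε) ^ 2⌉₊, fun P hP => ?_⟩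
  have hP' : (1 / ε) ^ 2 ≤ (P.card : ℝ) := Nat.ceil_le.1 hP
  have hlarge : 1 / ε ≤ √(3 * P.card) := Real.le_sqrt_of_sq_le (by linarith [sq_nonneg (1 / ε)])
  rw [div_le_iff₀ hε] at hlarge
  have hcard := twelve_mul_card_le_sq (fun p : ℤ × ℤ => p.1) (fun p => p.2)
    (fun p => -(p.1 + p.2)) (fun p => by ring) (fun p q => Prod.ext) P
  have hbd := two_mul_card_images_le_triBoundary P
  set s := (P.image fun p => p.1).card + (P.image fun p => p.2).card +
      (P.image fun p => -(p.1 + p.2)).card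
  have hcard' : 12 * (P.card : ℝ) ≤ ((s : ℝ) + 1) ^ 2 := by exact_mod_cast hcard
  have hbd' : 2 * (s : ℝ) ≤ triBoundary P := by exact_mod_cast hbd
  have hsqrt : √(3 * P.card) ≤ ((s : ℝ) + 1) / 2 :=
    Real.sqrt_le_iff.2 ⟨by positivity, by linarith⟩
  linarith
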